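/- arXiv:1609.01116 — 6 statements merged into one kernel-verified Lean document; each statement's English description precedes it below -/
import Mathlib

section
/- Let v be a vertex of a finite connected simple graph G and let H be a subgraph of G containing v and at least one vertex from each connected component of G − v. Then for any k pairwise level-disjoint level partitions S^1, …, S^k of H rooted at v, there exist k pairwise level-disjoint level partitions T^1, …, T^k of G rooted at v extending them, i.e., such that S^i_j ⊆ T^i_j for every 1 ≤ i ≤ k and every 0 ≤ j ≤ h(S^i). -/
open SimpleGraph

variable {V : Type*}

/-- `L = (S_0, …, S_h)` is a level partition of the vertex set `U` with respect to the
adjacency relation `Adj`: the levels are nonempty, pairwise disjoint, their union is `U`,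
and every vertex of a level `S_i` (`i ≥ 1`) has a neighbor in the previous level `S_{i-1}`. -/
def IsLevelPartitionOn (Adj : V → V → Prop) (U : Set V) (L : List (Finset V)) : Prop :=
  L ≠ [] ∧
  (∀ i, i < L.length → (L.getD i ∅).Nonempty) ∧
  (∀ i j, i < L.length → j < L.length → i ≠ j → Disjoint (L.getD i ∅) (L.getD j ∅)) ∧
  (∀ x : V, x ∈ U ↔ ∃ i < L.length, x ∈ L.getD i ∅) ∧
  (∀ i, 1 ≤ i → i < L.length → ∀ u ∈ L.getD i ∅, ∃ w ∈ L.getD (i - 1) ∅, Adj u w)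

/-- A level partition of the graph `G` (on its whole vertex set). -/
def IsLevelPartition (G : SimpleGraph V) (L : List (Finset V)) : Prop :=
  IsLevelPartitionOn G.Adj Set.univ L

/-- A level partition is rooted at `v` if its level `0` is the singleton `{v}`. -/
def RootedAt (v : V) (L : List (Finset V)) : Prop :=
  L.getD 0 ∅ = {v}

/-- Two level partitions are level-disjoint if their levels `i` are disjoint
for every `1 ≤ i ≤ min(h, h')`. -/
def LevelDisjoint (L M : List (Finset V)) : Prop :=
  ∀ i, 1 ≤ i → i < L.length → i < M.length → Disjoint (L.getD i ∅) (M.getD i ∅)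

/-- `C` is (the vertex set of) a connected component of `G − v`:
it is nonempty, avoids `v`, is connected in `G`, and is closed under adjacency avoiding `v`. -/
def IsCompOfDelete (G : SimpleGraph V) (v : V) (C : Set V) : Prop :=
  C.Nonempty ∧ v ∉ C ∧ (G.induce C).Preconnected ∧
  ∀ x ∈ C, ∀ y : V, G.Adj x y → y ≠ v → y ∈ C

/-- `l i x` is the level of `x` in the `i`-th member of a family of pairwise level-disjoint
level partitions of `U` rooted at `v`. -/
structure IsLevelFamily {ι : Type*} (G : SimpleGraph V) (v : V) (U : Set V)
    (l : ι → V → ℕ) : Prop where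
  root : ∀ i, l i v = 0
  parent : ∀ i, ∀ x ∈ U, x ≠ v → ∃ w ∈ U, G.Adj x w ∧ l i x = l i w + 1
  disjoint : ∀ i j, i ≠ j → ∀ x ∈ U, x ≠ v → l i x ≠ l j x

/-- The set of vertices reachable from `x ≠ v` without passing through `v` is a component
of `G - v`. -/
theorem isCompOfDelete_reflTransGen (G : SimpleGraph V) {v x : V} (hx : x ≠ v) :
    IsCompOfDelete G v {y | Relation.ReflTransGen (fun a b => G.Adj a b ∧ b ≠ v) x y} := by
  refine ⟨⟨x, .refl⟩, fun h => ?_, ?_, fun y hy z hyz hz => hy.tail ⟨hyz, hz⟩⟩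
  · rcases Relation.ReflTransGen.cases_tail h with h | ⟨_, _, _, h⟩
    · exact hx h.symm
    · exact h rfl
  · set C : Set V := {y | Relation.ReflTransGen (fun a b => G.Adj a b ∧ b ≠ v) x y}
    have reach : ∀ y (hy : y ∈ C), (G.induce C).Reachable ⟨x, .refl⟩ ⟨y, hy⟩ := by
      intro y hy
      induction hy with
      | refl => exact .rfl
      | tail _ hbc ih =>
        refine ih.trans (SimpleGraph.Adj.reachable ?_)
        exact hbc.1
    exact fun a b => (reach a a.2).symm.trans (reach b b.2)

/-- If `U` contains `v` and meets every component of `G - v`, then either it is the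
whole vertex set or some vertex outside has a neighbor in it different from `v`. -/
theorem exists_adj_of_meets_components (G : SimpleGraph V) {v : V} {U : Set V} (hv : v ∈ U)
    (hcomp : ∀ C : Set V, IsCompOfDelete G v C → ∃ u ∈ C, u ∈ U) (hU : U ≠ Set.univ) :
    ∃ x ∉ U, ∃ u ∈ U, u ≠ v ∧ G.Adj x u := by
  obtain ⟨x, hx⟩ := (Set.ne_univ_iff_exists_notMem U).1 hU
  have hxv : x ≠ v := fun h => hx (h ▸ hv)
  obtain ⟨u, hu, huU⟩ := hcomp _ (isCompOfDelete_reflTransGen G hxv)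
  by_contra! hcon
  refine absurd huU ?_
  clear huU
  induction hu with
  | refl => exact hx
  | tail _ hbc ih => exact fun hc => hcon _ ih _ hc hbc.2 hbc.1

/-- Giving a new vertex `x` the levels of a neighbor `u ≠ v`, increased by one, extends
a level family. -/
theorem IsLevelFamily.insert_vertex [DecidableEq V] {ι : Type*} {G : SimpleGraph V} {v : V} {U : Set V}
    {l : ι → V → ℕ} (h : IsLevelFamily G v U l) (hv : v ∈ U) {x u : V} (hx : x ∉ U) (hu : u ∈ U)
    (huv : u ≠ v) (hxu : G.Adj x u) :
    IsLevelFamily G v (insert x U) (fun i => Function.update (l i) x (l i u + 1)) := by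
  have ne : ∀ y ∈ U, y ≠ x := fun y hy e => hx (e ▸ hy)
  refine ⟨fun i => ?_, fun i y hy hyv => ?_, fun i j hij y hy hyv => ?_⟩
  · simp [ne v hv, h.root]
  · rcases hy with rfl | hy
    · exact ⟨u, .inr hu, hxu, by simp [ne u hu]⟩
    · obtain ⟨w, hw, hadj, hl⟩ := h.parent i y hy hyv
      exact ⟨w, .inr hw, hadj, by simp [ne y hy, ne w hw, hl]⟩
  · rcases hy with rfl | hy
    · simpa using h.disjoint i j hij u hu huv
    · simpa [ne y hy] using h.disjoint i j hij y hy hyv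

/-- A level family on a set meeting every component of `G - v` extends to all vertices. -/
theorem IsLevelFamily.exists_extension [Fintype V] [DecidableEq V] {ι : Type*}
    {G : SimpleGraph V} {v : V} {U : Set V} {l : ι → V → ℕ} (h : IsLevelFamily G v U l)
    (hv : v ∈ U) (hcomp : ∀ C : Set V, IsCompOfDelete G v C → ∃ u ∈ C, u ∈ U) :
    ∃ l' : ι → V → ℕ, IsLevelFamily G v Set.univ l' ∧ ∀ i, ∀ x ∈ U, l' i x = l i x := by
  induction hn : Uᶜ.ncard using Nat.strong_induction_on generalizing U l with
  | _ n ih =>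
    by_cases hU : U = Set.univ
    · subst hU
      exact ⟨l, h, fun _ _ _ => rfl⟩
    · obtain ⟨x, hx, u, hu, huv, hxu⟩ := exists_adj_of_meets_components G hv hcomp hU
      have hlt : (insert x U)ᶜ.ncard < n := by
        rw [← hn]
        refine Set.ncard_lt_ncard ?_ (Set.toFinite _)
        exact compl_lt_compl_iff_lt.2 (Set.ssubset_insert hx)
      obtain ⟨l', hl', hext⟩ := ih _ hlt (h.insert_vertex hv hx hu huv hxu) (.inr hv)
        (fun C hC => (hcomp C hC).imp fun _ hw => ⟨hw.1, .inr hw.2⟩) rfl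
      refine ⟨l', hl', fun i y hy => ?_⟩
      have hyx : y ≠ x := fun e => hx (e ▸ hy)
      simpa [hyx] using hext i y (.inr hy)

/-- The fibers of a level function form a level partition. -/
theorem exists_isLevelPartition_of_level [Fintype V] {G : SimpleGraph V} {v : V}
    {l : V → ℕ} (hroot : l v = 0) (hparent : ∀ x, x ≠ v → ∃ w, G.Adj x w ∧ l x = l w + 1) :
    ∃ L : List (Finset V), IsLevelPartition G L ∧ ∀ n x, x ∈ L.getD n ∅ ↔ l x = n := by
  classical
  obtain ⟨m, -, hm⟩ := Finset.exists_max_image Finset.univ l ⟨v, Finset.mem_univ v⟩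
  have hle : ∀ x, l x ≤ l m := fun x => hm x (Finset.mem_univ x)
  set L := (List.range (l m + 1)).map fun n => Finset.univ.filter fun x => l x = n with hL
  have hlen : L.length = l m + 1 := by simp [hL]
  have hmem : ∀ n x, x ∈ L.getD n ∅ ↔ l x = n := by
    intro n x
    by_cases hn : n < l m + 1
    · simp [hL, List.getD_eq_getElem?_getD, hn]
    · have := hle x
      rw [List.getD_eq_default _ _ (by omega)]
      simp only [Finset.notMem_empty, false_iff]
      omega
  have hsurj : ∀ d n, n + d = l m → ∃ x, l x = n := by
    intro d
    induction d with
    | zero => exact fun n hn => ⟨m, hn.symm⟩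
    | succ d ih =>
      intro n hn
      obtain ⟨x, hx⟩ := ih (n + 1) (by omega)
      obtain ⟨w, -, hw⟩ := hparent x (by rintro rfl; omega)
      exact ⟨w, by omega⟩
  refine ⟨L, ⟨?_, fun n hn => ?_, fun i j _ _ hij => ?_, fun x => ?_, fun n hn _ x hx => ?_⟩, hmem⟩
  · exact List.ne_nil_of_length_pos (by omega)
  · obtain ⟨x, hx⟩ := hsurj (l m - n) n (by omega)
    exact ⟨x, (hmem n x).2 hx⟩
  · refine Finset.disjoint_left.2 fun x hi hj => hij ?_
    rw [← (hmem i x).1 hi, ← (hmem j x).1 hj]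
  · have := hle x
    simpa using ⟨l x, by omega, (hmem _ x).2 rfl⟩
  · rw [hmem] at hx
    obtain ⟨w, hadj, hw⟩ := hparent x (by rintro rfl; omega)
    exact ⟨w, (hmem _ w).2 (by omega), hadj⟩

/-- A level partition of `U` is given by a level function on `U`. -/
theorem IsLevelPartitionOn.exists_level {Adj : V → V → Prop} {U : Set V} {L : List (Finset V)}
    (h : IsLevelPartitionOn Adj U L) :
    ∃ l : V → ℕ, (∀ x ∈ U, l x < L.length ∧ x ∈ L.getD (l x) ∅) ∧
      ∀ n x, n < L.length → x ∈ L.getD n ∅ → x ∈ U ∧ l x = n := by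
  obtain ⟨-, -, hdisj, hU, -⟩ := h
  have hex : ∀ x, ∃ n, x ∈ U → n < L.length ∧ x ∈ L.getD n ∅ := by
    intro x
    by_cases hx : x ∈ U
    · exact ((hU x).1 hx).imp fun _ hn _ => hn
    · exact ⟨0, fun h => absurd h hx⟩
  choose l hl using hex
  refine ⟨l, hl, fun n x hn hx => ?_⟩
  have hxU := (hU x).2 ⟨n, hn, hx⟩
  refine ⟨hxU, ?_⟩
  by_contra hne
  exact Finset.disjoint_left.1 (hdisj _ _ (hl x hxU).1 hn hne) (hl x hxU).2 hx

/-- Any `k` `v`-rooted level-disjoint partitions of a subgraph `H` of `G`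
containing `v` and a vertex from each component of `G − v` can be extended to `k` `v`-rooted
level-disjoint partitions of `G`. -/
theorem extend_rooted_LDPs_of_subgraph {V : Type*} [Fintype V] [DecidableEq V]
    (G : SimpleGraph V) (hG : G.Connected) (v : V)
    (H : G.Subgraph) (hv : v ∈ H.verts)
    (hcomp : ∀ C : Set V, IsCompOfDelete G v C → ∃ u ∈ C, u ∈ H.verts)
    (k : ℕ) (S : Fin k → List (Finset V))
    (hpart : ∀ i, IsLevelPartitionOn H.Adj H.verts (S i))
    (hroot : ∀ i, RootedAt v (S i))
    (hld : ∀ i j, i ≠ j → LevelDisjoint (S i) (S j)) :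
    ∃ T : Fin k → List (Finset V),
      (∀ i, IsLevelPartition G (T i)) ∧
      (∀ i, RootedAt v (T i)) ∧
      (∀ i j, i ≠ j → LevelDisjoint (T i) (T j)) ∧
      (∀ i : Fin k, ∀ j, j < (S i).length → (S i).getD j ∅ ⊆ (T i).getD j ∅) := by
  choose l hl hl' using fun i => (hpart i).exists_level
  have hpos : ∀ i, ∀ x ∈ H.verts, x ≠ v → 1 ≤ l i x := by
    intro i x hx hxv
    by_contra hlt
    have hmem := (hl i x hx).2
    rw [show l i x = 0 by omega, hroot i] at hmem
    exact hxv (Finset.mem_singleton.1 hmem)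
  have hfam : IsLevelFamily G v H.verts l := by
    refine ⟨fun i => ?_, fun i x hx hxv => ?_, fun i j hij x hx hxv heq => ?_⟩
    · have hmem : v ∈ (S i).getD 0 ∅ := by rw [hroot i]; exact Finset.mem_singleton_self v
      exact (hl' i 0 v (List.length_pos_of_ne_nil (hpart i).1) hmem).2
    · obtain ⟨hlt, hmem⟩ := hl i x hx
      obtain ⟨w, hw, hadj⟩ := (hpart i).2.2.2.2 _ (hpos i x hx hxv) hlt x hmem
      have := hpos i x hx hxv
      obtain ⟨hwH, hlw⟩ := hl' i _ w (by omega) hw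
      exact ⟨w, hwH, hadj.adj_sub, by omega⟩
    · obtain ⟨hlt, hmem⟩ := hl i x hx
      obtain ⟨hlt', hmem'⟩ := hl j x hx
      rw [← heq] at hlt' hmem'
      exact Finset.disjoint_left.1 (hld i j hij _ (hpos i x hx hxv) hlt hlt') hmem hmem'
  obtain ⟨t, ht, hext⟩ := hfam.exists_extension hv hcomp
  have hparent : ∀ i x, x ≠ v → ∃ w, G.Adj x w ∧ t i x = t i w + 1 := fun i x hx =>
    (ht.parent i x (Set.mem_univ x) hx).imp fun _ hw => hw.2
  choose T hT hmem using fun i => exists_isLevelPartition_of_level (ht.root i) (hparent i)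
  refine ⟨T, hT, fun i => ?_, fun i j hij n hn _ _ => ?_, fun i n hn x hx => ?_⟩
  · ext x
    rw [hmem, Finset.mem_singleton]
    refine ⟨fun hx => ?_, fun hx => hx ▸ ht.root i⟩
    by_contra hxv
    obtain ⟨w, -, hw⟩ := hparent i x hxv
    omega
  · refine Finset.disjoint_left.2 fun x hi hj => ?_
    rw [hmem] at hi hj
    refine ht.disjoint i j hij x (Set.mem_univ x) ?_ (hi.trans hj.symm)
    rintro rfl
    have := ht.root i
    omega
  · obtain ⟨hxH, hlx⟩ := hl' i n x hn hx
    rw [hmem, hext i x hxH, hlx]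
end

section
/- Let G be a finite simple graph, v a vertex of G, and C an even cycle of G through v written as the concatenation C = (vAu, uDw, wBv) of three internally disjoint subpaths: A from v to u of length a ≥ 1, D from u to w of length d ≥ 1, and B from w to v of length b ≥ 1, with a ≥ b. Let P be a chordal path to C with endvertices u and w. Then P separates v and the opposite vertex v̄_C on C if and only if a < b + d. -/
open SimpleGraph

variable {V : Type*}

/-- In a concatenation `A ++ D ++ B`, the vertices of the middle walk `D` are those at
positions `|A| + i` with `i ≤ |D|`. -/
theorem SimpleGraph.Walk.getVert_append_append_add {V : Type*} {G : SimpleGraph V}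
    {v u w z : V} (A : G.Walk v u) (D : G.Walk u w) (B : G.Walk w z) {i : ℕ}
    (hi : i ≤ D.length) :
    (A.append (D.append B)).getVert (A.length + i) = D.getVert i := by
  rw [Walk.getVert_append, if_neg (by omega), Nat.add_sub_cancel_left, Walk.getVert_append]
  split_ifs with h
  · rfl
  · obtain rfl : i = D.length := by omega
    simp

/-- **Observation on chordal paths.** Let `C = (vAu, uDw, wBv)` be an even
cycle through `v` written as the concatenation of three internally disjoint nontrivial
subpaths `A, D, B` with `|A| = a ≥ |B| = b`, and let `P` be a chordal path to `C` with
endvertices `u, w`.  Then `P` separates `v` and the opposite vertex `v̄_C` (i.e. `v̄_C`,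
the vertex at distance `|C|/2` from `v` along `C`, is an internal vertex of `D`) if and
only if `a < b + d`. -/
theorem chordal_separates_iff {V : Type*} [Fintype V] [DecidableEq V]
    (G : SimpleGraph V) {v u w : V}
    (A : G.Walk v u) (D : G.Walk u w) (B : G.Walk w v) (P : G.Walk u w)
    (hC : (A.append (D.append B)).IsCycle)
    (hEven : Even (A.append (D.append B)).length)
    (ha : 1 ≤ A.length) (hd : 1 ≤ D.length) (hb : 1 ≤ B.length)
    (hba : B.length ≤ A.length)
    (hP : P.IsPath)
    (hchordal : ∀ x ∈ P.support, x ∈ (A.append (D.append B)).support → x = u ∨ x = w) :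
    ((A.append (D.append B)).getVert ((A.append (D.append B)).length / 2) ∈ D.support ∧
     (A.append (D.append B)).getVert ((A.append (D.append B)).length / 2) ≠ u ∧
     (A.append (D.append B)).getVert ((A.append (D.append B)).length / 2) ≠ w) ↔
    A.length < B.length + D.length := by
  have hlen : (A.append (D.append B)).length = A.length + (D.length + B.length) := by
    simp only [Walk.length_append]
  have hu : (A.append (D.append B)).getVert A.length = u := by
    simpa using Walk.getVert_append_append_add A D B (Nat.zero_le _)
  have hw : (A.append (D.append B)).getVert (A.length + D.length) = w := by
    simpa using Walk.getVert_append_append_add A D B le_rfl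
  have hinj := hC.getVert_injOn
  obtain ⟨m, hm⟩ := hEven
  have hhalf : (A.append (D.append B)).length / 2 = m := by omega
  rw [hhalf]
  constructor
  · rintro ⟨hmem, hne, -⟩
    obtain ⟨i, hi, hid⟩ := Walk.mem_support_iff_exists_getVert.1 hmem
    rw [← Walk.getVert_append_append_add A D B hid] at hi
    have him : A.length + i = m :=
      hinj (by simp only [Set.mem_ofPred_eq]; omega) (by simp only [Set.mem_ofPred_eq]; omega) hi
    have hma : m ≠ A.length := fun h => hne (h ▸ hu)
    omega
  · intro hlt
    refine ⟨?_, fun h => ?_, fun h => ?_⟩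
    · obtain ⟨i, rfl⟩ : ∃ i, m = A.length + i := ⟨m - A.length, by omega⟩
      rw [Walk.getVert_append_append_add A D B (by omega)]
      exact D.getVert_mem_support i
    · have : m = A.length :=
        hinj (by simp only [Set.mem_ofPred_eq]; omega) (by simp only [Set.mem_ofPred_eq]; omega)
          (h.trans hu.symm)
      omega
    · have : m = A.length + D.length :=
        hinj (by simp only [Set.mem_ofPred_eq]; omega) (by simp only [Set.mem_ofPred_eq]; omega)
          (h.trans hw.symm)
      omega
end

section
/- Let G be a finite connected simple graph and let S^1, …, S^k be k level-disjoint partitions of G rooted at the same vertex v. Then for every vertex u ≠ v of G: min(R(u)) ≥ d(u,v) and max(R(u)) ≥ d(u,v) + k − 1, where d(u,v) is the graph distance from u to v. -/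
open SimpleGraph

variable {V : Type*}

/-- In a level partition rooted at `v`, a vertex of level `l` is at distance at most `l`
from `v`. -/
theorem IsLevelPartition.dist_le {G : SimpleGraph V} (hG : G.Connected) {v : V}
    {L : List (Finset V)} (hL : IsLevelPartition G L) (hv : RootedAt v L) {l : ℕ} {x : V}
    (hx : x ∈ L.getD l ∅) : G.dist x v ≤ l := by
  induction l generalizing x with
  | zero =>
    rw [show L.getD 0 ∅ = {v} from hv, Finset.mem_singleton] at hx
    simp [hx]
  | succ l ih =>
    have hl : l + 1 < L.length := by
      by_contra! h
      rw [List.getD_eq_default _ _ h] at hx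
      exact Finset.notMem_empty x hx
    obtain ⟨w, hw, hadj⟩ := hL.2.2.2.2 (l + 1) (by lia) hl x hx
    have htri := hG.dist_triangle (u := x) (v := w) (w := v)
    rw [dist_eq_one_iff_adj.mpr hadj] at htri
    have := ih hw
    lia

/-- If `S^1, …, S^k` (`k ≥ 1`) are level-disjoint partitions of a finite
connected graph `G` rooted at the same vertex `v`, then for every vertex `u ≠ v` we have
`min R(u) ≥ d(u,v)` (every level in which `u` occurs is at least `d(u,v)`) and
`max R(u) ≥ d(u,v) + k - 1` (some level in which `u` occurs is at least `d(u,v) + k - 1`). -/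
theorem levels_of_vertex_bounds {V : Type*} [Fintype V] [DecidableEq V]
    (G : SimpleGraph V) (hG : G.Connected) (v : V) (k : ℕ) (hk : 1 ≤ k)
    (S : Fin k → List (Finset V))
    (hpart : ∀ i, IsLevelPartition G (S i))
    (hroot : ∀ i, RootedAt v (S i))
    (hld : ∀ i j, i ≠ j → LevelDisjoint (S i) (S j))
    (u : V) (hu : u ≠ v) :
    (∀ l : ℕ, (∃ i : Fin k, u ∈ (S i).getD l ∅) → G.dist u v ≤ l) ∧
    (∃ l : ℕ, (∃ i : Fin k, u ∈ (S i).getD l ∅) ∧ G.dist u v + k - 1 ≤ l) := by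
  have hlower : ∀ l : ℕ, (∃ i : Fin k, u ∈ (S i).getD l ∅) → G.dist u v ≤ l :=
    fun l ⟨i, hi⟩ => (hpart i).dist_le hG (hroot i) hi
  refine ⟨hlower, ?_⟩
  choose f hflt hf using fun i => ((hpart i).2.2.2.1 u).mp (Set.mem_univ u)
  have hpos : 0 < G.dist u v := hG.pos_dist_of_ne hu
  have hinj : Function.Injective f := by
    intro i j hij
    by_contra hne
    have hle := hlower (f i) ⟨i, hf i⟩
    exact Finset.disjoint_left.mp (hld i j hne (f i) (by lia) (hflt i) (hij ▸ hflt j))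
      (hf i) (hij ▸ hf j)
  by_contra! hcon
  have hcard := Finset.card_le_card_of_injOn (s := Finset.univ) f
    (t := Finset.Ico (G.dist u v) (G.dist u v + k - 1))
    (fun i _ => Finset.mem_coe.mpr <| Finset.mem_Ico.mpr
      ⟨hlower _ ⟨i, hf i⟩, hcon _ ⟨i, hf i⟩⟩) hinj.injOn
  rw [Finset.card_univ, Fintype.card_fin, Nat.card_Ico] at hcard
  lia
end

section
/- Let v be a vertex of a finite connected simple graph G and let C be a connected component of G − v. If G has k level-disjoint partitions rooted at v, then the subgraph of G induced on V(C) ∪ {v} also has k level-disjoint partitions rooted at v; consequently, k ≤ deg_{C+v}(v), the number of neighbors of v lying in C. -/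
open SimpleGraph

variable {V : Type*}

lemma List.lt_length_of_mem_getD {α : Type*} {L : List (Finset α)} {i : ℕ} {x : α}
    (hx : x ∈ L.getD i ∅) : i < L.length := by
  by_contra h
  rw [List.getD_eq_default _ _ (not_lt.mp h)] at hx
  exact Finset.notMem_empty x hx

/-- Intersecting each level of a level partition rooted at `v` with `C ∪ {v}` gives, after
dropping the empty levels at the end, a level partition of the subgraph induced on `C ∪ {v}`. -/
lemma IsLevelPartition.exists_restrict {G : SimpleGraph V} {v : V} {C : Set V}
    (hC : IsCompOfDelete G v C) {L : List (Finset V)}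
    (hL : IsLevelPartition G L) (hv : RootedAt v L) :
    ∃ M : List (Finset V),
      IsLevelPartitionOn (fun x y => G.Adj x y ∧ x ∈ C ∪ {v} ∧ y ∈ C ∪ {v}) (C ∪ {v}) M ∧
      ∀ i x, x ∈ M.getD i ∅ ↔ x ∈ L.getD i ∅ ∧ x ∈ C ∪ {v} := by
  classical
  obtain ⟨-, -, hdisj, hcover, hadj⟩ := hL
  obtain ⟨-, -, -, hclosed⟩ := hC
  set F : ℕ → Finset V := fun i => (L.getD i ∅).filter (· ∈ C ∪ {v}) with hF
  have memF : ∀ i x, x ∈ F i ↔ x ∈ L.getD i ∅ ∧ x ∈ C ∪ {v} := fun i x => by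
    simp only [hF, Finset.mem_filter]
  have hv0 : v ∈ L.getD 0 ∅ := by rw [hv]; exact Finset.mem_singleton_self v
  have parent : ∀ i, ∀ u ∈ F (i + 1), ∃ w ∈ F i, G.Adj u w := by
    intro i u hu
    obtain ⟨huL, huC⟩ := (memF _ _).1 hu
    have hlt := List.lt_length_of_mem_getD huL
    have huv : u ≠ v := by
      rintro rfl
      exact Finset.disjoint_left.1 (hdisj 0 (i + 1) (by omega) hlt (by omega)) hv0 huL
    obtain ⟨w, hw, huw⟩ := hadj (i + 1) (by omega) hlt u huL
    refine ⟨w, (memF _ _).2 ⟨hw, ?_⟩, huw⟩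
    by_cases hwv : w = v
    · exact Or.inr hwv
    · exact Or.inl (hclosed u (huC.resolve_right huv) w huw hwv)
  have hempty : ∃ n, F n = ∅ := by
    refine ⟨L.length, Finset.eq_empty_of_forall_notMem fun x hx => ?_⟩
    exact (List.lt_length_of_mem_getD ((memF _ _).1 hx).1).false
  set h := Nat.find hempty
  have hnonempty : ∀ i < h, (F i).Nonempty := fun i hi =>
    Finset.nonempty_iff_ne_empty.2 (Nat.find_min hempty hi)
  have hzero : ∀ i, h ≤ i → F i = ∅ := by
    intro i hi
    induction i, hi using Nat.le_induction with
    | base => exact Nat.find_spec hempty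
    | succ i _ ih =>
      refine Finset.eq_empty_of_forall_notMem fun u hu => ?_
      obtain ⟨w, hw, -⟩ := parent i u hu
      simp [ih] at hw
  have hlen : ((List.range h).map F).length = h := by simp
  have hget : ∀ i, ((List.range h).map F).getD i ∅ = F i := by
    intro i
    rcases lt_or_ge i h with hi | hi
    · rw [List.getD_eq_getElem _ _ (by simpa using hi)]
      simp
    · rw [List.getD_eq_default _ _ (by simpa using hi), hzero i hi]
  have lt_of_mem : ∀ i x, x ∈ F i → i < h := by
    intro i x hx
    by_contra hi
    simp [hzero i (not_lt.1 hi)] at hx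
  refine ⟨(List.range h).map F, ⟨?_, ?_, ?_, ?_, ?_⟩, fun i x => by rw [hget, memF]⟩
  · have : 0 < h := lt_of_mem 0 v ((memF _ _).2 ⟨hv0, Or.inr rfl⟩)
    exact List.ne_nil_of_length_pos (by omega)
  · intro i hi
    rw [hget]
    exact hnonempty i (hlen ▸ hi)
  · intro i j _ _ hij
    rw [hget, hget, Finset.disjoint_left]
    intro x hxi hxj
    have hxi := ((memF _ _).1 hxi).1
    have hxj := ((memF _ _).1 hxj).1
    exact Finset.disjoint_left.1 (hdisj i j (List.lt_length_of_mem_getD hxi)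
      (List.lt_length_of_mem_getD hxj) hij) hxi hxj
  · intro x
    simp only [hget, hlen]
    constructor
    · intro hx
      obtain ⟨i, -, hi⟩ := (hcover x).1 trivial
      have hxF := (memF i x).2 ⟨hi, hx⟩
      exact ⟨i, lt_of_mem i x hxF, hxF⟩
    · rintro ⟨i, -, hi⟩
      exact ((memF i x).1 hi).2
  · intro i hi _ u hu
    rw [hget] at hu ⊢
    obtain ⟨i, rfl⟩ := Nat.exists_eq_add_of_le' hi
    obtain ⟨w, hw, huw⟩ := parent i u hu
    exact ⟨w, hw, huw, ((memF _ _).1 hu).2, ((memF _ _).1 hw).2⟩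

/-- Level `1` of a rooted level partition of the subgraph induced on `C ∪ {v}` contains a
neighbor of `v` lying in `C`. -/
lemma IsLevelPartitionOn.exists_adj_mem_level_one {G : SimpleGraph V} {v : V} {C : Set V}
    (hne : C.Nonempty) (hvC : v ∉ C) {M : List (Finset V)}
    (hM : IsLevelPartitionOn (fun x y => G.Adj x y ∧ x ∈ C ∪ {v} ∧ y ∈ C ∪ {v}) (C ∪ {v}) M)
    (hv : RootedAt v M) :
    ∃ u, u ∈ C ∧ G.Adj v u ∧ u ∈ M.getD 1 ∅ := by
  obtain ⟨-, hnonempty, -, hcover, hadj⟩ := hM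
  obtain ⟨c, hc⟩ := hne
  obtain ⟨j, hj, hcj⟩ := (hcover c).1 (Or.inl hc)
  have hj0 : j ≠ 0 := by
    rintro rfl
    rw [hv, Finset.mem_singleton] at hcj
    exact hvC (hcj ▸ hc)
  obtain ⟨u, hu⟩ := hnonempty 1 (by omega)
  obtain ⟨w, hw, huw, huC, -⟩ := hadj 1 le_rfl (by omega) u hu
  rw [Nat.sub_self, hv, Finset.mem_singleton] at hw
  subst hw
  exact ⟨u, huC.resolve_right huw.ne, huw.symm, hu⟩

/-- If `G` has `k` level-disjoint partitions rooted at `v` and `C` is a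
connected component of `G − v`, then the subgraph of `G` induced on `C ∪ {v}` also has
`k` level-disjoint partitions rooted at `v`; consequently `k ≤ deg_{C+v}(v)`, the number
of neighbors of `v` lying in `C`. -/
theorem rooted_LDPs_restrict_to_component {V : Type*} [Fintype V] [DecidableEq V]
    (G : SimpleGraph V) (hG : G.Connected) (v : V)
    (C : Set V) (hC : IsCompOfDelete G v C)
    (k : ℕ) (S : Fin k → List (Finset V))
    (hpart : ∀ i, IsLevelPartition G (S i))
    (hroot : ∀ i, RootedAt v (S i))
    (hld : ∀ i j, i ≠ j → LevelDisjoint (S i) (S j)) :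
    (∃ T : Fin k → List (Finset V),
      (∀ i, IsLevelPartitionOn
        (fun x y => G.Adj x y ∧ x ∈ C ∪ {v} ∧ y ∈ C ∪ {v}) (C ∪ {v}) (T i)) ∧
      (∀ i, RootedAt v (T i)) ∧
      (∀ i j, i ≠ j → LevelDisjoint (T i) (T j))) ∧
    k ≤ {u ∈ C | G.Adj v u}.ncard := by
  choose T hT hmem using fun i => (hpart i).exists_restrict hC (hroot i)
  have hrootT : ∀ i, RootedAt v (T i) := by
    intro i
    have h0 : (S i).getD 0 ∅ = {v} := hroot i
    refine Finset.ext fun x => ?_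
    rw [hmem, h0, Finset.mem_singleton]
    exact and_iff_left_of_imp Or.inr
  have hdisjT : ∀ i j, i ≠ j → LevelDisjoint (T i) (T j) := by
    intro i j hij n hn _ _
    rw [Finset.disjoint_left]
    intro x hxi hxj
    have hxi := ((hmem i n x).1 hxi).1
    have hxj := ((hmem j n x).1 hxj).1
    exact Finset.disjoint_left.1 (hld i j hij n hn (List.lt_length_of_mem_getD hxi)
      (List.lt_length_of_mem_getD hxj)) hxi hxj
  refine ⟨⟨T, hT, hrootT, hdisjT⟩, ?_⟩
  choose u huC hadj hu using fun i =>
    (hT i).exists_adj_mem_level_one hC.1 hC.2.1 (hrootT i)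
  have hinj : Function.Injective u := by
    intro i j hij
    by_contra hne
    have huj : u i ∈ (T j).getD 1 ∅ := hij ▸ hu j
    exact Finset.disjoint_left.1 (hdisjT i j hne 1 le_rfl
      (List.lt_length_of_mem_getD (hu i)) (List.lt_length_of_mem_getD huj)) (hu i) huj
  calc k = (Set.range u).ncard := by
        rw [← Set.image_univ, Set.ncard_image_of_injective _ hinj, Set.ncard_univ, Nat.card_fin]
    _ ≤ {u ∈ C | G.Adj v u}.ncard :=
        Set.ncard_le_ncard (Set.range_subset_iff.2 fun i => ⟨huC i, hadj i⟩) (Set.toFinite _)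
end

section
/- Let v be a vertex of a finite connected simple graph G. If for every connected component C of G − v the subgraph of G induced on V(C) ∪ {v} has k level-disjoint partitions rooted at v, then G has k level-disjoint partitions rooted at v (obtained by taking unions of corresponding levels over the components). -/
open SimpleGraph

variable {V : Type*}

/-- The connected component of `x` in `G - v`, as a component of the graph obtained from `G` by
isolating `v`, is a component of `G - v`. -/
theorem isCompOfDelete_supp (G : SimpleGraph V) {v x : V} (hx : x ≠ v) :
    IsCompOfDelete G v ((G.deleteIncidenceSet v).connectedComponentMk x).supp := by
  refine ⟨⟨x, rfl⟩, fun hv => ?_, ?_, fun y hy z hyz hz => ?_⟩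
  · obtain ⟨p⟩ := ConnectedComponent.exact hv
    cases p with
    | nil => exact hx rfl
    | cons hadj _ => exact (deleteIncidenceSet_adj.1 hadj).2.1 rfl
  · refine (ConnectedComponent.connected_toSimpleGraph _).preconnected.mono fun a b hab => ?_
    exact (deleteIncidenceSet_adj.1 hab).1
  · by_cases hyv : y = v
    · subst hyv
      obtain ⟨p⟩ := ConnectedComponent.exact hy
      cases p with
      | nil => exact absurd rfl hx
      | cons hadj _ => exact absurd rfl (deleteIncidenceSet_adj.1 hadj).2.1
    · have hadj : (G.deleteIncidenceSet v).Adj z y :=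
        deleteIncidenceSet_adj.2 ⟨hyz.symm, hz, hyv⟩
      exact (ConnectedComponent.sound hadj.reachable).trans hy

/-- The list of level sets of a function `d : V → ℕ` on a finite type. -/
def levelList [Fintype V] (d : V → ℕ) : List (Finset V) :=
  (List.range (Finset.univ.sup d + 1)).map fun n => Finset.univ.filter fun x => d x = n

theorem length_levelList [Fintype V] (d : V → ℕ) :
    (levelList d).length = Finset.univ.sup d + 1 := by
  simp [levelList]

theorem mem_getD_levelList [Fintype V] (d : V → ℕ) (n : ℕ) (x : V) :
    x ∈ (levelList d).getD n ∅ ↔ d x = n := by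
  by_cases hn : n < Finset.univ.sup d + 1
  · simp [levelList, List.getD, hn]
  · have hx : d x ≤ Finset.univ.sup d := Finset.le_sup (Finset.mem_univ x)
    have hne : d x ≠ n := by omega
    simp [levelList, List.getD, hn, hne]

/-- If every vertex of positive depth has a neighbor whose depth is smaller by one, then the level
sets of the depth function form a level partition. -/
theorem isLevelPartition_levelList [Fintype V] [Nonempty V] (G : SimpleGraph V) (d : V → ℕ)
    (hd : ∀ x n, d x = n + 1 → ∃ y, d y = n ∧ G.Adj x y) :
    IsLevelPartition G (levelList d) := by
  have descend : ∀ m n, (∃ x, d x = n + m) → ∃ x, d x = n := by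
    intro m
    induction m with
    | zero => exact fun n hx => hx
    | succ m ih =>
      rintro n ⟨x, hx⟩
      obtain ⟨y, hy, -⟩ := hd x (n + m) (by omega)
      exact ih n ⟨y, hy⟩
  refine ⟨?_, fun n hn => ?_, fun i j _ _ hij => ?_, fun x => ?_, fun n hn _ u hu => ?_⟩
  · simp [← List.length_pos_iff, length_levelList]
  · rw [length_levelList] at hn
    obtain ⟨x, -, hx⟩ := Finset.exists_mem_eq_sup Finset.univ Finset.univ_nonempty d
    obtain ⟨y, hy⟩ := descend (Finset.univ.sup d - n) n ⟨x, by omega⟩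
    exact ⟨y, (mem_getD_levelList d n y).2 hy⟩
  · refine Finset.disjoint_left.2 fun x hi hj => hij ?_
    rw [mem_getD_levelList] at hi hj
    exact hi.symm.trans hj
  · refine iff_of_true (Set.mem_univ x) ⟨d x, ?_, (mem_getD_levelList d _ x).2 rfl⟩
    rw [length_levelList]
    exact Nat.lt_succ_of_le (Finset.le_sup (Finset.mem_univ x))
  · rw [mem_getD_levelList] at hu
    obtain ⟨y, hy, hadj⟩ := hd u (n - 1) (by omega)
    exact ⟨y, (mem_getD_levelList d _ y).2 hy, hadj⟩

/-- If for every connected component `C` of `G − v` the subgraph of `G`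
induced on `C ∪ {v}` has `k` level-disjoint partitions rooted at `v`, then `G` has `k`
level-disjoint partitions rooted at `v`. -/
theorem rooted_LDPs_compose_from_components {V : Type*} [Fintype V] [DecidableEq V]
    (G : SimpleGraph V) (hG : G.Connected) (v : V) (k : ℕ)
    (h : ∀ C : Set V, IsCompOfDelete G v C →
      ∃ T : Fin k → List (Finset V),
        (∀ i, IsLevelPartitionOn
          (fun x y => G.Adj x y ∧ x ∈ C ∪ {v} ∧ y ∈ C ∪ {v}) (C ∪ {v}) (T i)) ∧
        (∀ i, RootedAt v (T i)) ∧
        (∀ i j, i ≠ j → LevelDisjoint (T i) (T j))) :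
    ∃ S : Fin k → List (Finset V),
      (∀ i, IsLevelPartition G (S i)) ∧
      (∀ i, RootedAt v (S i)) ∧
      (∀ i j, i ≠ j → LevelDisjoint (S i) (S j)) := by
  classical
  let comp : V → Set V := fun x => ((G.deleteIncidenceSet v).connectedComponentMk x).supp
  have self_mem_comp : ∀ x, x ∈ comp x := fun x => rfl
  have comp_eq : ∀ x y, y ∈ comp x → comp y = comp x := fun x y hy =>
    congrArg ConnectedComponent.supp hy
  choose! T hT hroot hdisj using h
  have exists_level : ∀ i x, x ≠ v → ∃ n, 1 ≤ n ∧ n < (T (comp x) i).length ∧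
      x ∈ (T (comp x) i).getD n ∅ := by
    intro i x hx
    have hc : IsCompOfDelete G v (comp x) := isCompOfDelete_supp G hx
    obtain ⟨n, hn, hxn⟩ := ((hT _ hc i).2.2.2.1 x).1 (Or.inl (self_mem_comp x))
    refine ⟨n, Nat.one_le_iff_ne_zero.2 ?_, hn, hxn⟩
    rintro rfl
    have hr : (T (comp x) i).getD 0 ∅ = {v} := hroot _ hc i
    exact hx (Finset.mem_singleton.1 (hr ▸ hxn))
  choose! level one_le_level level_lt mem_level using exists_level
  let depth : Fin k → V → ℕ := fun i x => if x = v then 0 else level i x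
  have depth_root : ∀ i, depth i v = 0 := fun i => if_pos rfl
  have depth_of_ne : ∀ i x, x ≠ v → depth i x = level i x := fun i x hx => if_neg hx
  have ne_root : ∀ i x, depth i x ≠ 0 → x ≠ v := fun i x hx hxv => hx (hxv ▸ depth_root i)
  have : Nonempty V := ⟨v⟩
  refine ⟨fun i => levelList (depth i), fun i => isLevelPartition_levelList G _ ?_, fun i => ?_,
    fun i j hij n hn _ _ => ?_⟩
  · intro x n hxn
    have hx := ne_root i x (by omega)
    have hc : IsCompOfDelete G v (comp x) := isCompOfDelete_supp G hx
    rw [depth_of_ne i x hx] at hxn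
    have hlt := level_lt i x hx
    obtain ⟨w, hw, hadj, -, hwc⟩ :=
      (hT _ hc i).2.2.2.2 _ (one_le_level i x hx) hlt x (mem_level i x hx)
    refine ⟨w, ?_, hadj⟩
    have hwn : w ∈ (T (comp x) i).getD n ∅ := by
      rw [hxn] at hw
      exact hw
    have hr : (T (comp x) i).getD 0 ∅ = {v} := hroot _ hc i
    have unique : ∀ m, m < (T (comp x) i).length → w ∈ (T (comp x) i).getD m ∅ → m = n := by
      intro m hm hwm
      by_contra hne
      exact Finset.disjoint_left.1 ((hT _ hc i).2.2.1 m n hm (by omega) hne) hwm hwn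
    by_cases hwv : w = v
    · rw [hwv, depth_root i]
      refine unique 0 (by omega) ?_
      rw [hr, hwv]
      exact Finset.mem_singleton_self v
    · have hcw := comp_eq x w (hwc.resolve_right hwv)
      have hwlt := level_lt i w hwv
      have hwmem := mem_level i w hwv
      rw [hcw] at hwlt hwmem
      rw [depth_of_ne i w hwv]
      exact unique _ hwlt hwmem
  · ext x
    rw [mem_getD_levelList, Finset.mem_singleton]
    refine ⟨fun hx => ?_, fun hx => hx ▸ depth_root i⟩
    by_contra hxv
    have := one_le_level i x hxv
    rw [depth_of_ne i x hxv] at hx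
    omega
  · refine Finset.disjoint_left.2 fun x hxi hxj => ?_
    rw [mem_getD_levelList] at hxi hxj
    have hx := ne_root i x (by omega)
    rw [depth_of_ne _ x hx] at hxi hxj
    have hli := level_lt i x hx
    have hlj := level_lt j x hx
    have hmi := mem_level i x hx
    have hmj := mem_level j x hx
    rw [hxi] at hli hmi
    rw [hxj] at hlj hmj
    exact Finset.disjoint_left.1 (hdisj _ (isCompOfDelete_supp G hx) i j hij n hn hli hlj) hmi hmj
end

section
/- Let G be a finite simple graph and let P_1 = (u_1, …, u_m) and P_2 = (w_1, …, w_n) be merged level-disjoint paths in G (so u_1 = w_n and w_1 = u_m). Then there exist fully-merged level-disjoint paths P_1' from u_1 to u_m and P_2' from w_1 to w_n whose vertices and edges all lie in P_1 ∪ P_2. -/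
open SimpleGraph

variable {V : Type*}

/-- In a relation on `ℕ × ℕ` that avoids the diagonal, is bounded in the first coordinate and
meets both axes, there are consecutive minimal elements `a`, `b` on the two sides of the
diagonal. -/
lemma exists_minimal_pair_across_diagonal {C : ℕ × ℕ → Prop} {p q : ℕ}
    (hdiag : ∀ i, ¬ C (i, i)) (hbound : ∀ c, C c → c.1 ≤ p) (hq : C (0, q)) (hp : C (p, 0)) :
    ∃ a b, Minimal C a ∧ Minimal C b ∧ a.1 < a.2 ∧ b.2 < b.1 ∧ a.1 < b.1 ∧ b.2 < a.2 ∧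
      ∀ c, C c → c.1 ≤ b.1 → c.2 ≤ a.2 → c.2 = a.2 ∨ c.1 = b.1 := by
  classical
  have hoff : ∀ c, C c → c.1 ≠ c.2 := fun c hc h => hdiag c.1 (by convert hc)
  obtain ⟨a₀, ha₀le, ha₀⟩ := exists_minimal_le_of_wellFoundedLT C _ hq
  obtain ⟨b₀, hb₀le, hb₀⟩ := exists_minimal_le_of_wellFoundedLT C _ hp
  have hlow : ∃ i, ∃ a, Minimal C a ∧ a.1 < a.2 ∧ a.1 = i := by
    refine ⟨_, a₀, ha₀, ?_, rfl⟩
    have := hoff _ ha₀.prop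
    have := ha₀le.1
    simp only at this
    omega
  have hhigh : ∃ j, ∃ b, Minimal C b ∧ b.2 < b.1 ∧ b.1 = j := by
    refine ⟨_, b₀, hb₀, ?_, rfl⟩
    have := hoff _ hb₀.prop
    have := hb₀le.2
    simp only at this
    omega
  obtain ⟨i₀, hi₀⟩ := hlow
  obtain ⟨a, ha, ha', hai⟩ :=
    Nat.findGreatest_spec (P := fun i => ∃ a, Minimal C a ∧ a.1 < a.2 ∧ a.1 = i) (n := p)
      (by obtain ⟨a, ha, -, rfl⟩ := hi₀; exact hbound _ ha.prop) hi₀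
  have hamax : ∀ c, Minimal C c → c.1 < c.2 → c.1 ≤ a.1 := fun c hc hlt => by
    rw [hai]
    exact Nat.le_findGreatest (hbound _ hc.prop) ⟨c, hc, hlt, rfl⟩
  obtain ⟨b, hb, hb', hbj⟩ := Nat.find_spec hhigh
  have hbmin : ∀ c, Minimal C c → c.2 < c.1 → b.1 ≤ c.1 := fun c hc hlt => by
    rw [hbj]
    exact Nat.find_min' hhigh ⟨c, hc, hlt, rfl⟩
  have hne : ¬ b ≤ a := fun h => by
    obtain rfl := ha.eq_of_le hb.prop h
    omega
  have hne' : ¬ a ≤ b := fun h => by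
    obtain rfl := hb.eq_of_le ha.prop h
    omega
  rw [Prod.le_def] at hne hne'
  refine ⟨a, b, ha, hb, ha', hb', by omega, by omega, fun c hc hcb hca => ?_⟩
  obtain ⟨d, hdc, hd⟩ := exists_minimal_le_of_wellFoundedLT C c hc
  have hd1 := hdc.1
  have hd2 := hdc.2
  rcases lt_or_gt_of_ne (hoff d hd.prop) with h | h
  · have hda : d ≤ a := ⟨hamax d hd h, hd2.trans hca⟩
    obtain rfl := ha.eq_of_le hd.prop hda
    omega
  · have := hbmin d hd h
    omega

namespace SimpleGraph.Walk

variable {G : SimpleGraph V}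

lemma exists_append_of_getVert_eq {x y a : V} (W : G.Walk x y) {i : ℕ} (hi : i ≤ W.length)
    (ha : W.getVert i = a) :
    ∃ (A : G.Walk x a) (B : G.Walk a y), W = A.append B ∧ A.length = i := by
  subst ha
  refine ⟨W.take i, W.drop i, ?_, by simp [take_length, hi]⟩
  simp

lemma exists_append_append_of_getVert_eq {x y a b : V} (W : G.Walk x y) {i j : ℕ} (hij : i ≤ j)
    (hj : j ≤ W.length) (ha : W.getVert i = a) (hb : W.getVert j = b) :
    ∃ (A : G.Walk x a) (M : G.Walk a b) (B : G.Walk b y),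
      W = A.append (M.append B) ∧ A.length = i ∧ A.length + M.length = j := by
  obtain ⟨A', B, rfl, hA'⟩ := W.exists_append_of_getVert_eq hj hb
  obtain ⟨A, M, rfl, hA⟩ := A'.exists_append_of_getVert_eq (i := i) (a := a) (by omega)
    (by rw [← ha, getVert_append', if_pos (by omega)])
  exact ⟨A, M, B, by rw [append_assoc], hA, by rw [← hA', length_append]⟩

lemma IsPath.append_reverse {x y b : V} {P : G.Walk x b} {Q : G.Walk y b} (hP : P.IsPath)
    (hQ : Q.IsPath)
    (hPQ : ∀ i ≤ P.length, ∀ j ≤ Q.length, P.getVert i = Q.getVert j →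
      i = P.length ∧ j = Q.length) :
    (P.append Q.reverse).IsPath := by
  rw [← IsPath.getVert_injOn_iff]
  intro k hk l hl hkl
  simp only [Set.mem_ofPred_eq, length_append, length_reverse] at hk hl
  simp only [getVert_append', getVert_reverse] at hkl
  split_ifs at hkl with h h' h'
  · exact hP.getVert_injOn h h' hkl
  · have := hPQ _ h _ (by omega) hkl
    omega
  · have := hPQ _ h' _ (by omega) hkl.symm
    omega
  · have := hQ.getVert_injOn (by simp) (by simp) hkl
    omega

end SimpleGraph.Walk

/-- Merged level-disjoint paths `P₁` (from `x` to `y`) and `P₂` (from `y`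
to `x`) can be adjusted into fully-merged level-disjoint paths `P₁' = A ++ P ++ B` and
`P₂' = (A ++ D ++ B).reverse` between the same endvertices (so that `A` is a common prefix,
`B` a common suffix of `P₁'` and `P₂'.reverse`, and `P`, `D` are internally
vertex-disjoint), all of whose vertices and edges lie in `P₁ ∪ P₂`. -/
theorem merged_to_fully_merged {V : Type*} [Fintype V] [DecidableEq V]
    (G : SimpleGraph V) {x y : V} (P₁ : G.Walk x y) (P₂ : G.Walk y x)
    (h₁ : P₁.IsPath) (h₂ : P₂.IsPath)
    (hld : ∀ i, 1 ≤ i → i ≤ min P₁.length P₂.length → P₁.getVert i ≠ P₂.getVert i) :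
    ∃ (a b : V) (A : G.Walk x a) (P : G.Walk a b) (D : G.Walk a b) (B : G.Walk b y),
      (A.append (P.append B)).IsPath ∧
      ((A.append (D.append B)).reverse).IsPath ∧
      (∀ i, 1 ≤ i →
        i ≤ min (A.append (P.append B)).length ((A.append (D.append B)).reverse).length →
        (A.append (P.append B)).getVert i ≠ ((A.append (D.append B)).reverse).getVert i) ∧
      (∀ c ∈ P.support, c ∈ D.support → c = a ∨ c = b) ∧
      (∀ c ∈ (A.append (P.append B)).support, c ∈ P₁.support ∨ c ∈ P₂.support) ∧
      (∀ c ∈ ((A.append (D.append B)).reverse).support, c ∈ P₁.support ∨ c ∈ P₂.support) ∧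
      (∀ e ∈ (A.append (P.append B)).edges, e ∈ P₁.edges ∨ e ∈ P₂.edges) ∧
      (∀ e ∈ ((A.append (D.append B)).reverse).edges, e ∈ P₁.edges ∨ e ∈ P₂.edges) := by
  by_cases hxy : x = y
  · subst hxy
    refine ⟨x, x, .nil, .nil, .nil, .nil, ?_⟩
    simp +contextual [Nat.one_le_iff_ne_zero]
  obtain ⟨⟨i, r⟩, ⟨j, t⟩, ha, hb, hir, htj, hij, htr, hbetween⟩ :=
    exists_minimal_pair_across_diagonal
      (C := fun c => c.1 ≤ P₁.length ∧ c.2 ≤ P₂.length ∧ P₁.getVert c.1 = P₂.getVert c.2)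
      (p := P₁.length) (q := P₂.length)
      (by
        rintro (_ | i) ⟨h, h', h''⟩
        · exact hxy (by simpa using h'')
        · exact hld _ (by simp) (le_min h h') h'')
      (fun c hc => hc.1) (by simp) (by simp)
  simp only at hir htj hij htr hbetween
  obtain ⟨hi, hr, hirv⟩ := ha.prop
  obtain ⟨hj, ht, hjtv⟩ := hb.prop
  simp only at hi hr hirv hj ht hjtv
  have hamin : ∀ k ≤ i, ∀ l ≤ r, P₁.getVert k = P₂.getVert l → k = i ∧ l = r := by
    intro k hk l hl h
    have := ha.eq_of_le (y := (k, l)) ⟨hk.trans hi, hl.trans hr, h⟩ ⟨hk, hl⟩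
    simp_all
  have hbmin : ∀ k ≤ j, ∀ l ≤ t, P₁.getVert k = P₂.getVert l → k = j ∧ l = t := by
    intro k hk l hl h
    have := hb.eq_of_le (y := (k, l)) ⟨hk.trans hj, hl.trans ht, h⟩ ⟨hk, hl⟩
    simp_all
  obtain ⟨a, hia⟩ : ∃ a, P₁.getVert i = a := ⟨_, rfl⟩
  obtain ⟨b, hjb⟩ : ∃ b, P₁.getVert j = b := ⟨_, rfl⟩
  obtain ⟨A, P, E, hP₁, hA, hAP⟩ :=
    P₁.exists_append_append_of_getVert_eq hij.le hj hia hjb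
  obtain ⟨B, D, F, hP₂, hB, hBD⟩ :=
    P₂.exists_append_append_of_getVert_eq htr.le hr (hjtv.symm.trans hjb) (hirv.symm.trans hia)
  have hpath₁ : (A.append P).IsPath := by
    rw [hP₁, Walk.append_assoc] at h₁
    exact h₁.of_append_left
  have hpath₂ : (B.append D).IsPath := by
    rw [hP₂, Walk.append_assoc] at h₂
    exact h₂.of_append_left
  have hgetAP : ∀ k ≤ j, (A.append P).getVert k = P₁.getVert k := fun k hk => by
    conv_rhs => rw [hP₁, Walk.append_assoc, Walk.getVert_append', Walk.length_append,
      if_pos (by omega)]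
  have hgetA : ∀ k ≤ i, A.getVert k = P₁.getVert k := fun k hk => by
    conv_rhs => rw [hP₁, Walk.getVert_append', if_pos (by omega)]
  have hgetBD : ∀ k ≤ r, (B.append D).getVert k = P₂.getVert k := fun k hk => by
    conv_rhs => rw [hP₂, Walk.append_assoc, Walk.getVert_append', Walk.length_append,
      if_pos (by omega)]
  have hgetB : ∀ k ≤ t, B.getVert k = P₂.getVert k := fun k hk => by
    conv_rhs => rw [hP₂, Walk.getVert_append', if_pos (by omega)]
  have hlAP : (A.append P).length = j := by rw [Walk.length_append, hAP]
  have hlBD : (B.append D).length = r := by rw [Walk.length_append, hBD]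
  have hfst : A.append (P.append B.reverse) = (A.append P).append B.reverse :=
    Walk.append_assoc ..
  have hsnd : (A.append (D.reverse.append B.reverse)).reverse =
      (B.append D).append A.reverse := by
    simp [Walk.reverse_append]
  refine ⟨a, b, A, P, D.reverse, B.reverse, ?_⟩
  rw [hfst, hsnd]
  refine ⟨?_, ?_, ?_, ?_, ?_, ?_, ?_, ?_⟩
  · refine hpath₁.append_reverse hpath₂.of_append_left fun k hk l hl h => ?_
    rw [hlAP] at hk ⊢
    rw [hB] at hl ⊢
    rw [hgetAP k hk, hgetB l hl] at h
    exact hbmin k hk l hl h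
  · refine hpath₂.append_reverse hpath₁.of_append_left fun k hk l hl h => ?_
    rw [hlBD] at hk ⊢
    rw [hA] at hl ⊢
    rw [hgetBD k hk, hgetA l hl] at h
    exact (hamin l hl k hk h.symm).symm
  · intro l hl hlmin h
    rw [Walk.length_append, Walk.length_append _ A.reverse, Walk.length_reverse,
      Walk.length_reverse, hlAP, hlBD, hA, hB, le_min_iff] at hlmin
    rw [Walk.getVert_append', Walk.getVert_append' _ A.reverse, Walk.getVert_reverse,
      Walk.getVert_reverse, hlAP, hlBD, hA, hB] at h
    split_ifs at h with hlj hlr hlr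
    · rw [hgetAP l hlj, hgetBD l hlr] at h
      exact hld l hl (le_min (hlj.trans hj) (hlr.trans hr)) h
    · rw [hgetAP l hlj, hgetA _ (by omega)] at h
      have := h₁.getVert_injOn (hlj.trans hj) (by simp; omega) h
      omega
    · rw [hgetBD l hlr, hgetB _ (by omega)] at h
      have := h₂.getVert_injOn (by simp; omega) (hlr.trans hr) h
      omega
    · rw [hgetB _ (by omega), hgetA _ (by omega)] at h
      have := hamin _ (by omega) _ (by omega) h.symm
      omega
  · intro c hcP hcD
    rw [Walk.support_reverse, List.mem_reverse] at hcD
    obtain ⟨k, rfl, hk⟩ := Walk.mem_support_iff_exists_getVert.1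
      (Walk.support_subset_support_append_right A P hcP)
    obtain ⟨l, hlk, hl⟩ := Walk.mem_support_iff_exists_getVert.1
      (Walk.support_subset_support_append_right B D hcD)
    rw [hlAP] at hk
    rw [hlBD] at hl
    rw [hgetAP k hk, hgetBD l hl] at hlk
    rw [hgetAP k hk]
    rcases hbetween (k, l) ⟨hk.trans hj, hl.trans hr, hlk.symm⟩ hk hl with h | h
    · left
      rw [← hlk, ← hia, hirv, ← h]
    · right
      rw [← hjb, ← h]
  iterate 2
    intro c hc
    rw [hP₁, hP₂]
    simp only [Walk.mem_support_append_iff, Walk.support_reverse, List.mem_reverse] at hc ⊢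
    clear * - hc
    tauto
  all_goals
    intro e he
    rw [hP₁, hP₂]
    simp only [Walk.edges_append, Walk.edges_reverse, List.mem_append, List.mem_reverse] at he ⊢
    clear * - he
    tauto
end
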